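/- For every fixed σ ≥ 2 there exist constants C_σ, C'_σ > 0 such that for all w, k with 11 ≤ w ≤ k−1, writing Δ_σ(w) = Dev_σ(k,w+1) − Dev_σ(k,w), one has ((2σ + 6 − C_σ·w)/((w+1)(w+2)))·σ^{w−1} < Δ_σ(w) < ((2σ + 6 − C'_σ·w)/((w+1)(w+2)))·σ^{w−1}. -/

import Mathlib

open Finset

/-- The `i`-th length-`k` substring (`k`-mer) of a word of length `w + k`
over the alphabet `Fin σ`. -/
def kmerAt (σ k w : ℕ) (v : Fin (w + k) → Fin σ) (i : Fin (w + 1)) : Fin k → Fin σ :=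
  fun j => v ⟨i.1 + j.1, by have h1 := i.2; have h2 := j.2; omega⟩

/-- `v` is a gamechanger with respect to the linear order (ranking) `ρ` on `k`-mers:
either its `k`-prefix is a `ρ`-minimal `k`-mer of `v`, or its `k`-suffix is a
`ρ`-minimal `k`-mer of `v` occurring exactly once in `v`. -/
def IsGC (σ k w : ℕ) (ρ : (Fin k → Fin σ) ≃ Fin (σ ^ k)) (v : Fin (w + k) → Fin σ) : Prop :=
  (∀ i : Fin (w + 1), ρ (kmerAt σ k w v 0) ≤ ρ (kmerAt σ k w v i)) ∨
  ((∀ i : Fin (w + 1), ρ (kmerAt σ k w v (Fin.last w)) ≤ ρ (kmerAt σ k w v i)) ∧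
    (∀ i : Fin (w + 1), kmerAt σ k w v i = kmerAt σ k w v (Fin.last w) → i = Fin.last w))

/-- `P_{σ,k}(v)`: the fraction of linear orders `ρ` on `σ`-ary `k`-strings for which
`v` is a gamechanger. -/
noncomputable def Pgc (σ k w : ℕ) (v : Fin (w + k) → Fin σ) : ℝ :=
  (Nat.card {ρ : (Fin k → Fin σ) ≃ Fin (σ ^ k) // IsGC σ k w ρ v} : ℝ) /
    (Nat.card ((Fin k → Fin σ) ≃ Fin (σ ^ k)) : ℝ)

/-- `D_ρ`: the fraction of gamechangers among all `σ`-ary strings of length `w + k`. -/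
noncomputable def Dens (σ k w : ℕ) (ρ : (Fin k → Fin σ) ≃ Fin (σ ^ k)) : ℝ :=
  (Nat.card {v : Fin (w + k) → Fin σ // IsGC σ k w ρ v} : ℝ) / ((σ : ℝ) ^ (w + k))

/-- `DR_σ(k,w)`: the expected density, i.e. the average of `D_ρ` over all orders `ρ`. -/
noncomputable def DR (σ k w : ℕ) : ℝ :=
  (∑ ρ : (Fin k → Fin σ) ≃ Fin (σ ^ k), Dens σ k w ρ) /
    (Nat.card ((Fin k → Fin σ) ≃ Fin (σ ^ k)) : ℝ)

/-- `DFR_σ(k,w) = (w+1) · DR_σ(k,w)`, the expected density factor. -/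
noncomputable def DFR (σ k w : ℕ) : ℝ := ((w : ℝ) + 1) * DR σ k w

/-- The number of distinct `k`-mers of `v`. -/
def numKmers (σ k w : ℕ) (v : Fin (w + k) → Fin σ) : ℕ :=
  (Finset.univ.image (kmerAt σ k w v)).card

/-- `Rep_{σ,k,w}`: the set of `σ`-ary strings of length `w + k` that contain two equal
`k`-substrings at distinct positions. -/
def RepSet (σ k w : ℕ) : Finset (Fin (w + k) → Fin σ) :=
  Finset.univ.filter fun v =>
    ∃ i j : Fin (w + 1), i ≠ j ∧ kmerAt σ k w v i = kmerAt σ k w v j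

/-- `Dev_σ(k,w)`, the deviation of the random order. -/
noncomputable def Dev (σ k w : ℕ) : ℝ :=
  (∑ v ∈ RepSet σ k w, Pgc σ k w v) - (2 / ((w : ℝ) + 1)) * ((RepSet σ k w).card : ℝ)

/-- `p` is a period of the string `s` (of length `n`): `s[i] = s[i+p]` whenever both
positions are inside `s`. -/
def HasPeriod (σ n : ℕ) (s : Fin n → Fin σ) (p : ℕ) : Prop :=
  ∀ (i : ℕ) (h : i + p < n), s ⟨i, by omega⟩ = s ⟨i + p, h⟩

/-- A string is primitive if it is not of the form `u^m` with `m ≥ 2`, equivalently it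
has no period that is a proper divisor of its length. -/
def IsPrimitive (σ n : ℕ) (s : Fin n → Fin σ) : Prop :=
  ¬ ∃ d, d ∣ n ∧ d < n ∧ HasPeriod σ n s d

/-- `Prim_σ(n)`: the number of primitive `σ`-ary strings of length `n`. -/
noncomputable def Prim (σ n : ℕ) : ℕ :=
  Nat.card {s : Fin n → Fin σ // IsPrimitive σ n s}

/-- The substring of `v` of length `ℓ` starting at (0-indexed) position `i`. -/
def subAt (σ n : ℕ) (v : Fin n → Fin σ) (i ℓ : ℕ) (h : i + ℓ ≤ n) : Fin ℓ → Fin σ :=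
  fun j => v ⟨i + j.1, by have := j.2; omega⟩

/-- A string is `p`-periodic if `p` is its minimal period and `p ≤ |s|/2`. -/
def IsPPeriodic (σ n : ℕ) (s : Fin n → Fin σ) (p : ℕ) : Prop :=
  1 ≤ p ∧ 2 * p ≤ n ∧ HasPeriod σ n s p ∧ ∀ q, 1 ≤ q → q < p → ¬ HasPeriod σ n s q

/-- The occurrence `v[i..i+ℓ)` is a run of period `p`: it is `p`-periodic and is not
contained in a longer `p`-periodic substring of `v`. -/
def IsRun (σ n : ℕ) (v : Fin n → Fin σ) (i ℓ p : ℕ) (h : i + ℓ ≤ n) : Prop :=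
  IsPPeriodic σ ℓ (subAt σ n v i ℓ h) p ∧
    ∀ (i' ℓ' : ℕ) (h' : i' + ℓ' ≤ n), i' ≤ i → i + ℓ ≤ i' + ℓ' → ℓ < ℓ' →
      ¬ IsPPeriodic σ ℓ' (subAt σ n v i' ℓ' h') p

/-- A major run: a run `x` of period `p` with `|x| ≥ |v|/2 + p`. -/
def IsMajorRun (σ n : ℕ) (v : Fin n → Fin σ) (i ℓ p : ℕ) (h : i + ℓ ≤ n) : Prop :=
  IsRun σ n v i ℓ p h ∧ n + 2 * p ≤ 2 * ℓ

def Per (u : ℕ → ℕ) (s e p : ℕ) : Prop := ∀ i, s ≤ i → i + p < e → u i = u (i + p)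

lemma Per.mono {u : ℕ → ℕ} {s e s' e' p : ℕ} (h : Per u s e p) (h1 : s ≤ s') (h2 : e' ≤ e) :
    Per u s' e' p := fun i hi hj => h i (by omega) (by omega)

lemma Per.mul {u : ℕ → ℕ} {s e p : ℕ} (h : Per u s e p) (c : ℕ) : Per u s e (p * c) := by
  induction c with
  | zero => intro i _ _; simp
  | succ c ih =>
    intro i h1 h2
    rw [Nat.mul_succ] at h2 ⊢
    rw [ih i h1 (by omega), h (i + p * c) (by omega) (by omega), add_assoc]

lemma Per.congr {u : ℕ → ℕ} {s e p : ℕ} (h : Per u s e p) {i j : ℕ} (hi : s ≤ i) (hi' : i < e)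
    (hj : s ≤ j) (hj' : j < e) (hm : i ≡ j [MOD p]) : u i = u j := by
  rcases le_total i j with hij | hij
  · obtain ⟨c, hc⟩ := (Nat.modEq_iff_dvd' hij).1 hm
    have := h.mul c i hi (by omega)
    rw [this, ← hc]; congr 1; omega
  · obtain ⟨c, hc⟩ := (Nat.modEq_iff_dvd' hij).1 hm.symm
    have := h.mul c j hj (by omega)
    rw [this, ← hc]; congr 1; omega

lemma exists_rep (s p i : ℕ) (hp : 1 ≤ p) : ∃ j, s ≤ j ∧ j < s + p ∧ j ≡ i [MOD p] := by
  obtain ⟨p', rfl⟩ : ∃ p', p = p' + 1 := ⟨p - 1, by omega⟩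
  refine ⟨s + (i + s * p') % (p' + 1), by omega, ?_, ?_⟩
  · have := Nat.mod_lt (i + s * p') (show 0 < p' + 1 by omega); omega
  · have h1 : s + (i + s * p') % (p' + 1) ≡ s + (i + s * p') [MOD (p' + 1)] :=
      Nat.ModEq.add_left _ (Nat.mod_modEq _ _)
    refine h1.trans ?_
    have : s + (i + s * p') = i + (p' + 1) * s := by ring
    rw [this]
    simp [Nat.ModEq]

lemma Per.extend {u : ℕ → ℕ} {s e s' e' p d : ℕ} (h : Per u s e p) (hp : 1 ≤ p) (hd : d ∣ p)
    (h1 : s ≤ s') (h2 : e' ≤ e) (h3 : s' + p ≤ e') (h' : Per u s' e' d) : Per u s e d := by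
  intro i hi hj
  obtain ⟨j, hj1, hj2, hj3⟩ := exists_rep s' p i hp
  obtain ⟨l, hl1, hl2, hl3⟩ := exists_rep s' p (i + d) hp
  rw [h.congr hi (by omega) (show s ≤ j by omega) (by omega) hj3.symm,
    h.congr (show s ≤ i + d by omega) hj (show s ≤ l by omega) (by omega) hl3.symm]
  apply h'.congr hj1 (by omega) hl1 (by omega)
  refine (hj3.of_dvd hd).trans (Nat.ModEq.trans ?_ (hl3.of_dvd hd).symm)
  simp [Nat.ModEq]

lemma fine_wilf (u : ℕ → ℕ) (s e : ℕ) : ∀ N p q : ℕ, p + q ≤ N → s + p + q ≤ e → Per u s e p →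
    Per u s e q → Per u s e (Nat.gcd p q) := by
  have key : ∀ p q : ℕ, p ≤ q → s + p + q ≤ e → Per u s e p → Per u s e q →
      Per u s e (q - p) := by
    intro p q hpq he hp hq i hi hj
    by_cases h : i + q < e
    · rw [hq i hi h, hp (i + (q - p)) (by omega) (by omega)]; congr 1; omega
    · have h1 := hp (i - p) (by omega) (by omega)
      have h2 := hq (i - p) (by omega) (by omega)
      rw [show i - p + p = i by omega] at h1
      rw [← h1, h2]; congr 1; omega
  intro N
  induction N with
  | zero => intro p q h _ hp _; obtain rfl : p = 0 := by omega
            obtain rfl : q = 0 := by omega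
            simpa using hp
  | succ N ih =>
    intro p q h he hp hq
    rcases Nat.eq_zero_or_pos p with rfl | hp0
    · simpa using hq
    rcases Nat.eq_zero_or_pos q with rfl | hq0
    · simpa using hp
    rcases le_total p q with hpq | hpq
    · have := ih p (q - p) (by omega) (by omega) hp (key p q hpq he hp hq)
      rwa [Nat.gcd_sub_self_right hpq] at this
    · have := ih (p - q) q (by omega) (by omega) (key q p hpq (by omega) hq hp) hq
      rwa [Nat.gcd_sub_self_left hpq] at this

/-- primitive periodic stretch -/
def HH (u : ℕ → ℕ) (n p a b : ℕ) : Prop :=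
  Per u a (n - b) p ∧ ∀ d, d ∣ p → d < p → ¬ Per u a (n - b) d

def FF (u : ℕ → ℕ) (n p a b : ℕ) : Prop :=
  HH u n p a b ∧ (0 < a → u (a - 1) ≠ u (a - 1 + p)) ∧ (0 < b → u (n - b - p) ≠ u (n - b))

lemma FF.key {u : ℕ → ℕ} {k w p a b : ℕ} (h : FF u (w + k) p a b) (hp : 1 ≤ p)
    (hs : p + a + b ≤ w) (hk : w ≤ k) {i j : ℕ} (hij : i < j) (hj : j ≤ w)
    (he : ∀ t < k, u (i + t) = u (j + t)) : a ≤ i ∧ j + b ≤ w ∧ p ∣ j - i := by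
  obtain ⟨⟨hper, hprim⟩, hl, hr⟩ := h
  have hq : Per u i (j + k) (j - i) := by
    intro l h1 h2
    have := he (l - i) (by omega)
    rw [show i + (l - i) = l by omega] at this
    rw [this]; congr 1; omega
  have hm : Per u (max i a) (min (j + k) (w + k - b)) (Nat.gcd p (j - i)) :=
    fine_wilf u _ _ _ _ _ le_rfl (by omega) (hper.mono (by omega) (by omega))
      (hq.mono (by omega) (by omega))
  have hgp : Nat.gcd p (j - i) = p := by
    by_contra hne
    have hlt := lt_of_le_of_ne (Nat.gcd_le_left (j - i) hp) hne
    exact hprim _ (Nat.gcd_dvd_left _ _) hlt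
      (hper.extend hp (Nat.gcd_dvd_left _ _) (by omega) (by omega) (by omega) hm)
  have hdvd : p ∣ j - i := by rw [← hgp]; exact Nat.gcd_dvd_right _ _
  have hqp : Per u i (j + k) p := by
    rw [hgp] at hm
    exact hq.extend (by omega) hdvd (by omega) (by omega) (by omega) hm
  refine ⟨?_, ?_, hdvd⟩
  · by_contra hlt
    exact hl (by omega) (hqp _ (by omega) (by omega))
  · by_contra hlt
    have := hqp (w + k - b - p) (by omega) (by omega)
    rw [show w + k - b - p + p = w + k - b by omega] at this
    exact hr (by omega) this

lemma FF.conv {u : ℕ → ℕ} {k w p a b : ℕ} (h : FF u (w + k) p a b) {i j : ℕ}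
    (hi : a ≤ i) (hi' : i + b ≤ w) (hj : a ≤ j) (hj' : j + b ≤ w) (hm : i ≡ j [MOD p]) :
    ∀ t < k, u (i + t) = u (j + t) := by
  intro t ht
  exact h.1.1.congr (by omega) (by omega) (by omega) (by omega) (hm.add_right t)

lemma FF.exists {u : ℕ → ℕ} {k w i j : ℕ} (hk : w ≤ k) (hij : i < j) (hj : j ≤ w)
    (he : ∀ t < k, u (i + t) = u (j + t)) :
    ∃ p a b, 1 ≤ p ∧ p + a + b ≤ w ∧ FF u (w + k) p a b := by
  classical
  have ex : ∃ p, 1 ≤ p ∧ ∃ i, i + p ≤ w ∧ Per u i (i + p + k) p := by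
    refine ⟨j - i, by omega, i, by omega, ?_⟩
    intro l h1 h2
    have := he (l - i) (by omega)
    rw [show i + (l - i) = l by omega] at this
    rw [this]; congr 1; omega
  obtain ⟨hp, i0, hi0, hper⟩ := Nat.find_spec ex
  have hmin := fun q => @Nat.find_min _ _ ex q
  set p := Nat.find ex with hpdef
  have exa : ∃ a, Per u a (i0 + p + k) p := ⟨i0, hper⟩
  have ha := Nat.find_spec exa
  have hale : Nat.find exa ≤ i0 := Nat.find_min' exa hper
  have hamin := fun q => @Nat.find_min _ _ exa q
  set a := Nat.find exa with hadef
  have exb : ∃ b, Per u a (w + k - b) p := ⟨w - (i0 + p), by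
    convert ha using 1; omega⟩
  have hb := Nat.find_spec exb
  have hble : Nat.find exb ≤ w - (i0 + p) := Nat.find_min' exb (by convert ha using 1; omega)
  have hbmin := fun q => @Nat.find_min _ _ exb q
  set b := Nat.find exb with hbdef
  refine ⟨p, a, b, hp, by omega, ⟨hb, ?_⟩, ?_, ?_⟩
  · intro d hd hdp hper'
    have hd1 : 1 ≤ d := Nat.pos_of_dvd_of_pos hd hp
    exact hmin d hdp ⟨hd1, a, by omega, hper'.mono le_rfl (by omega)⟩
  · intro h0 heq
    apply hamin (a - 1) (by omega)
    intro l h1 h2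
    rcases Nat.lt_or_ge l a with h3 | h3
    · obtain rfl : l = a - 1 := by omega
      exact heq
    · exact ha l h3 h2
  · intro h0 heq
    apply hbmin (b - 1) (by omega)
    intro l h1 h2
    by_cases h3 : l + p < w + k - b
    · exact hb l h1 h3
    · have e1 : l = w + k - b - p := by omega
      have e2 : l + p = w + k - b := by omega
      rw [e2, e1]; exact heq

def ext' (σ n : ℕ) (v : Fin n → Fin σ) (i : ℕ) : ℕ := if h : i < n then (v ⟨i, h⟩ : ℕ) else 0

lemma ext'_eq {σ n : ℕ} (v : Fin n → Fin σ) {i : ℕ} (h : i < n) :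
    ext' σ n v i = (v ⟨i, h⟩ : ℕ) := by simp [ext', h]

lemma kmer_eq_iff {σ k w : ℕ} (v : Fin (w + k) → Fin σ) (i j : Fin (w + 1)) :
    kmerAt σ k w v i = kmerAt σ k w v j ↔
      ∀ t < k, ext' σ (w + k) v (i + t) = ext' σ (w + k) v (j + t) := by
  constructor
  · intro h t ht
    have := congrFun h ⟨t, ht⟩
    rw [ext'_eq v (by omega), ext'_eq v (by omega)]
    exact congrArg Fin.val this
  · intro h
    funext t
    have := h t t.2
    rw [ext'_eq v (by omega), ext'_eq v (by omega)] at this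
    exact Fin.ext this

/-- minimum probability lemma -/
lemma card_min {X : Type*} [Fintype X] [DecidableEq X] {N : ℕ} (S : Finset X) (x : X) (hx : x ∈ S) :
    (S.card) * Nat.card {ρ : X ≃ Fin N // ∀ y ∈ S, ρ x ≤ ρ y} = Nat.card (X ≃ Fin N) := by
  classical
  have hsymm : ∀ z ∈ S, Nat.card {ρ : X ≃ Fin N // ∀ y ∈ S, ρ z ≤ ρ y} =
      Nat.card {ρ : X ≃ Fin N // ∀ y ∈ S, ρ x ≤ ρ y} := by
    intro z hz
    have hmem : ∀ y ∈ S, Equiv.swap x z y ∈ S := by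
      intro y hy
      rw [Equiv.swap_apply_def]; split_ifs <;> assumption
    refine Nat.card_congr ⟨fun ρ => ⟨(Equiv.swap x z).trans ρ.1, ?_⟩,
      fun ρ => ⟨(Equiv.swap x z).trans ρ.1, ?_⟩, ?_, ?_⟩
    · intro y hy; simpa using ρ.2 _ (hmem y hy)
    · intro y hy; simpa using ρ.2 _ (hmem y hy)
    · intro ρ; ext y; simp
    · intro ρ; ext y; simp
  have huniq : ∀ ρ : X ≃ Fin N, (S.filter (fun z => ∀ y ∈ S, ρ z ≤ ρ y)).card = 1 := by
    intro ρ
    rw [Finset.card_eq_one]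
    obtain ⟨m, hm, hmin⟩ := Finset.exists_min_image S ρ ⟨x, hx⟩
    refine ⟨m, ?_⟩
    ext z
    simp only [Finset.mem_filter, Finset.mem_singleton]
    constructor
    · rintro ⟨hz, hz'⟩
      exact ρ.injective (le_antisymm (hz' m hm) (hmin z hz))
    · rintro rfl; exact ⟨hm, hmin⟩
  have hdc := Finset.sum_card_bipartiteAbove_eq_sum_card_bipartiteBelow
    (s := (Finset.univ : Finset (X ≃ Fin N))) (t := S)
    (fun ρ z => ∀ y ∈ S, ρ z ≤ ρ y)
  simp only [Finset.bipartiteAbove, Finset.bipartiteBelow] at hdc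
  rw [Finset.sum_congr rfl (fun ρ _ => huniq ρ)] at hdc
  have h2 : ∀ z ∈ S, (Finset.univ.filter (fun ρ : X ≃ Fin N => ∀ y ∈ S, ρ z ≤ ρ y)).card =
      Nat.card {ρ : X ≃ Fin N // ∀ y ∈ S, ρ x ≤ ρ y} := by
    intro z hz
    rw [← hsymm z hz, Nat.card_eq_fintype_card, Fintype.card_subtype]
  rw [Finset.sum_congr rfl h2] at hdc
  simp at hdc
  rw [Nat.card_eq_fintype_card (α := X ≃ Fin N), hdc]
  simp

lemma numKmers_FF {σ k w p a b : ℕ} {v : Fin (w + k) → Fin σ}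
    (h : FF (ext' σ (w + k) v) (w + k) p a b) (hp : 1 ≤ p) (hs : p + a + b ≤ w) (hk : w ≤ k) :
    numKmers σ k w v = p + a + b := by
  classical
  unfold numKmers
  have himg : (Finset.univ.image (kmerAt σ k w v)) =
      ((Finset.univ : Finset (Fin (w+1))).filter
        (fun i => i.1 < a + p ∨ w < i.1 + b)).image (kmerAt σ k w v) := by
    ext x
    simp only [Finset.mem_image, Finset.mem_univ, true_and, Finset.mem_filter]
    constructor
    · rintro ⟨i, rfl⟩
      by_cases hi : i.1 < a + p ∨ w < i.1 + b
      · exact ⟨i, hi, rfl⟩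
      · obtain ⟨j, h1, h2, h3⟩ := exists_rep a p i hp
        refine ⟨⟨j, by omega⟩, Or.inl h2, ?_⟩
        rw [kmer_eq_iff]
        exact h.conv h1 (by simp; omega) (by omega) (by omega) h3
    · rintro ⟨i, _, rfl⟩; exact ⟨i, rfl⟩
  rw [himg, Finset.card_image_of_injOn]
  · have : ((Finset.univ : Finset (Fin (w+1))).filter
        (fun i => i.1 < a + p ∨ w < i.1 + b)).map Fin.valEmbedding =
        Finset.range (a + p) ∪ Finset.Ico (w + 1 - b) (w + 1) := by
      ext x
      simp only [Finset.mem_map, Finset.mem_filter, Finset.mem_univ, true_and,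
        Fin.valEmbedding_apply, Finset.mem_union, Finset.mem_range, Finset.mem_Ico]
      constructor
      · rintro ⟨i, hi, rfl⟩; have := i.2; omega
      · intro hx; exact ⟨⟨x, by omega⟩, by simp; omega, rfl⟩
    rw [← Finset.card_map Fin.valEmbedding, this, Finset.card_union_of_disjoint]
    · simp; omega
    · rw [Finset.disjoint_left]; intro x; simp; omega
  · have aux : ∀ i j : Fin (w+1), (i.1 < a + p ∨ w < i.1 + b) → (j.1 < a + p ∨ w < j.1 + b) →
        i.1 < j.1 → kmerAt σ k w v i ≠ kmerAt σ k w v j := by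
      intro i j hi hj hij he
      rw [kmer_eq_iff] at he
      obtain ⟨h1, h2, h3⟩ := h.key hp hs hk hij (by omega) he
      have := Nat.le_of_dvd (by omega) h3
      omega
    intro i hi j hj he
    simp at hi hj
    rcases lt_trichotomy i.1 j.1 with hij | hij | hij
    · exact absurd he (aux i j hi hj hij)
    · exact Fin.ext hij
    · exact absurd he.symm (aux j i hj hi hij)

lemma Pgc_FF {σ k w p a b : ℕ} {v : Fin (w + k) → Fin σ} 
    (h : FF (ext' σ (w + k) v) (w + k) p a b) (hp : 1 ≤ p) (hs : p + a + b ≤ w) (hk : w ≤ k) :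
    Pgc σ k w v = (if b = 0 then 1 else 2) / ((p + a + b : ℕ) : ℝ) := by
  classical
  have hnum := numKmers_FF h hp hs hk
  unfold numKmers at hnum
  set S := Finset.univ.image (kmerAt σ k w v) with hS
  set T := Nat.card ((Fin k → Fin σ) ≃ Fin (σ ^ k)) with hT
  have hTpos : 0 < T := by
    have : Nonempty ((Fin k → Fin σ) ≃ Fin (σ ^ k)) :=
      ⟨Fintype.equivOfCardEq (by simp)⟩
    exact Nat.card_pos
  have hTpos' : (0:ℝ) < T := by exact_mod_cast hTpos
  have hd : (0:ℝ) < ((p + a + b : ℕ) : ℝ) := by exact_mod_cast (by omega : 0 < p + a + b)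
  have hcard : ∀ i : Fin (w + 1), (p + a + b) *
      (Finset.univ.filter (fun ρ : (Fin k → Fin σ) ≃ Fin (σ ^ k) =>
        ∀ j : Fin (w+1), ρ (kmerAt σ k w v i) ≤ ρ (kmerAt σ k w v j))).card = T := by
    intro i
    have := card_min (N := σ ^ k) S (kmerAt σ k w v i) (by simp [hS])
    rw [hnum, Nat.card_eq_fintype_card, Fintype.card_subtype] at this
    rw [hT, ← this]
    congr 2
    ext ρ
    simp [hS]
  have key : (p + a + b) * Nat.card {ρ : (Fin k → Fin σ) ≃ Fin (σ ^ k) // IsGC σ k w ρ v} =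
      (if b = 0 then 1 else 2) * T := by
    rw [Nat.card_eq_fintype_card, Fintype.card_subtype]
    by_cases hb : b = 0
    · rw [if_pos hb, one_mul, ← hcard 0]
      congr 2
      ext ρ
      simp only [Finset.mem_filter, Finset.mem_univ, true_and]
      unfold IsGC
      refine or_iff_left ?_
      rintro ⟨_, h2⟩
      have := h2 ⟨w - p, by omega⟩ (by
        rw [kmer_eq_iff]
        apply h.conv <;> simp
        any_goals omega
        show w - p ≡ w [MOD p]
        rw [Nat.modEq_iff_dvd' (by omega)]
        exact ⟨1, by omega⟩)
      have := congrArg Fin.val this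
      simp at this; omega
    · rw [if_neg hb]
      have huniq : ∀ i : Fin (w + 1), kmerAt σ k w v i = kmerAt σ k w v (Fin.last w) →
          i = Fin.last w := by
        intro i hi
        by_contra hne
        rw [kmer_eq_iff] at hi
        have hlt : i.1 < w := by
          have := i.2
          have : i.1 ≠ w := fun h => hne (Fin.ext h)
          omega
        have := h.key hp hs hk (i := i) (j := w) hlt le_rfl hi
        omega
      have : (Finset.univ.filter (fun ρ : (Fin k → Fin σ) ≃ Fin (σ ^ k) => IsGC σ k w ρ v)) =
        (Finset.univ.filter (fun ρ : (Fin k → Fin σ) ≃ Fin (σ ^ k) =>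
        ∀ j : Fin (w+1), ρ (kmerAt σ k w v 0) ≤ ρ (kmerAt σ k w v j))) ∪
        (Finset.univ.filter (fun ρ : (Fin k → Fin σ) ≃ Fin (σ ^ k) =>
        ∀ j : Fin (w+1), ρ (kmerAt σ k w v (Fin.last w)) ≤ ρ (kmerAt σ k w v j))) := by
        ext ρ
        simp only [Finset.mem_filter, Finset.mem_univ, true_and, Finset.mem_union]
        unfold IsGC
        tauto
      rw [this, Finset.card_union_of_disjoint, mul_add, hcard, hcard, two_mul]
      rw [Finset.disjoint_left]
      intro ρ h1 h2
      simp only [Finset.mem_filter, Finset.mem_univ, true_and] at h1 h2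
      have := ρ.injective (le_antisymm (h1 (Fin.last w)) (h2 0))
      have := congrArg Fin.val (huniq 0 this)
      simp at this; omega
  unfold Pgc
  rw [← hT, div_eq_div_iff hTpos'.ne' hd.ne', mul_comm]
  have := congrArg (Nat.cast (R := ℝ)) key
  push_cast at this ⊢
  exact this

lemma HH.root {σ n p a b : ℕ} {v : Fin n → Fin σ} (hp : 1 ≤ p) (hs : a + b + p ≤ n)
    (hper : Per (ext' σ n v) a (n - b) p) :
    HH (ext' σ n v) n p a b ↔ IsPrimitive σ p (fun j => v ⟨a + j.1, by have := j.2; omega⟩) := by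
  have hiff : ∀ d, d ∣ p → (Per (ext' σ n v) a (n - b) d ↔
      HasPeriod σ p (fun j => v ⟨a + j.1, by have := j.2; omega⟩) d) := by
    intro d hd
    constructor
    · intro h i hi
      have := h (a + i) (by omega) (by omega)
      rw [ext'_eq v (by omega), ext'_eq v (by omega)] at this
      have := Fin.ext this
      simpa [add_assoc] using this
    · intro h
      refine hper.extend hp hd (s' := a) (e' := a + p) le_rfl (by omega) le_rfl ?_
      intro i h1 h2
      have := h (i - a) (by omega)
      rw [ext'_eq v (by omega), ext'_eq v (by omega)]
      refine congrArg Fin.val ?_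
      convert this using 3 <;> (simp only; omega)
  unfold HH IsPrimitive
  constructor
  · rintro ⟨_, h⟩ ⟨d, hd, hlt, hd'⟩
    exact h d hd hlt ((hiff d hd).2 hd')
  · intro h
    refine ⟨hper, fun d hd hlt hd' => h ⟨d, hd, hlt, (hiff d hd).1 hd'⟩⟩

def glue (σ n p a b : ℕ) (hp : 1 ≤ p) (r : Fin p → Fin σ) (l : Fin a → Fin σ)
    (t : Fin b → Fin σ) : Fin n → Fin σ := fun i =>
  if h : i.1 < a then l ⟨i, h⟩ else
    if h2 : i.1 < n - b then r ⟨(i.1 - a) % p, Nat.mod_lt _ hp⟩ else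
      t ⟨i.1 - (n - b), by have := i.2; omega⟩

lemma glue_per (σ n p a b : ℕ) (hp : 1 ≤ p) (r : Fin p → Fin σ) (l : Fin a → Fin σ)
    (t : Fin b → Fin σ) : Per (ext' σ n (glue σ n p a b hp r l t)) a (n - b) p := by
  intro i h1 h2
  rw [ext'_eq _ (by omega), ext'_eq _ (by omega)]
  refine congrArg Fin.val ?_
  unfold glue
  simp only
  rw [dif_neg (by omega), dif_pos (by omega), dif_neg (by omega), dif_pos (by omega)]
  congr 2
  rw [show i + p - a = (i - a) + p by omega, Nat.add_mod_right]

lemma card_HH {σ n p a b : ℕ} (hp : 1 ≤ p) (hs : a + b + p ≤ n) :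
    Nat.card {v : Fin n → Fin σ // HH (ext' σ n v) n p a b} = Prim σ p * σ ^ a * σ ^ b := by
  have e : {v : Fin n → Fin σ // HH (ext' σ n v) n p a b} ≃
      {s : Fin p → Fin σ // IsPrimitive σ p s} × (Fin a → Fin σ) × (Fin b → Fin σ) := by
    refine ⟨fun v => (⟨fun j => v.1 ⟨a + j.1, by have := j.2; omega⟩, (HH.root hp hs v.2.1).1 v.2⟩,
      fun j => v.1 ⟨j.1, by have := j.2; omega⟩, fun j => v.1 ⟨n - b + j.1, by have := j.2; omega⟩),
      fun x => ⟨glue σ n p a b hp x.1.1 x.2.1 x.2.2, ?_⟩, ?_, ?_⟩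
    · rw [HH.root hp hs (glue_per _ _ _ _ _ _ _ _ _)]
      convert x.1.2 with j
      unfold glue
      have := j.2
      simp only
      rw [dif_neg (by omega), dif_pos (by omega)]
      congr 1
      ext
      simp [Nat.mod_eq_of_lt]
    · rintro ⟨v, hv⟩
      ext i
      simp only [glue]
      have := i.2
      split_ifs with h1 h2
      · rfl
      · have hm := Nat.mod_lt (i.1 - a) hp
        have := hv.1.congr (i := a + (i.1 - a) % p) (j := i.1) (by omega) (by omega) (by omega) h2 (by
          have : a + (i.1 - a) % p ≡ a + (i.1 - a) [MOD p] :=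
            Nat.ModEq.add_left _ (Nat.mod_modEq _ _)
          rwa [show a + (i.1 - a) = i.1 by omega] at this)
        rwa [ext'_eq v (by omega), ext'_eq v (by omega)] at this
      · refine congrArg (fun x => (v x).val) ?_
        ext; simp; omega
    · rintro ⟨⟨r, hr⟩, l, t⟩
      simp only [Prod.mk.injEq, Subtype.mk.injEq]
      refine ⟨?_, ?_, ?_⟩
      · funext j
        unfold glue
        have := j.2
        simp only
        rw [dif_neg (by omega), dif_pos (by omega)]
        congr 1
        ext
        simp [Nat.mod_eq_of_lt]
      · funext j
        unfold glue
        have := j.2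
        simp only
        rw [dif_pos (by omega)]
      · funext j
        unfold glue
        have := j.2
        simp only
        rw [dif_neg (by omega), dif_neg (by omega)]
        congr 1
        ext
        simp
  rw [Nat.card_congr e, Nat.card_prod, Nat.card_prod]
  simp [Prim, mul_assoc]

open Classical in
noncomputable def Hset (σ n p a b : ℕ) : Finset (Fin n → Fin σ) :=
  Finset.univ.filter fun v => HH (ext' σ n v) n p a b

open Classical in
noncomputable def Lset (σ n p a b : ℕ) : Finset (Fin n → Fin σ) :=
  Finset.univ.filter fun v => HH (ext' σ n v) n p a b ∧
    (0 < a → ext' σ n v (a - 1) ≠ ext' σ n v (a - 1 + p))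

open Classical in
noncomputable def Fset (σ n p a b : ℕ) : Finset (Fin n → Fin σ) :=
  Finset.univ.filter fun v => FF (ext' σ n v) n p a b

noncomputable def NN (σ a : ℕ) : ℝ := if a = 0 then 1 else (σ : ℝ) ^ a - (σ : ℝ) ^ (a - 1)

lemma card_Hset {σ n p a b : ℕ} (hp : 1 ≤ p) (hs : a + b + p ≤ n) :
    ((Hset σ n p a b).card : ℝ) = Prim σ p * (σ : ℝ) ^ a * (σ : ℝ) ^ b := by
  classical
  have := card_HH (σ := σ) hp hs
  rw [Nat.card_eq_fintype_card, Fintype.card_subtype] at this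
  unfold Hset
  rw [this]; push_cast; rfl

lemma HH_left {u : ℕ → ℕ} {n p a b : ℕ} (hp : 1 ≤ p) (hs : a + 1 + b + p ≤ n) :
    HH u n p a b ↔ HH u n p (a + 1) b ∧ u a = u (a + p) := by
  constructor
  · rintro ⟨h1, h2⟩
    refine ⟨⟨h1.mono (by omega) le_rfl, fun d hd hlt hd' => h2 d hd hlt ?_⟩,
      h1 a le_rfl (by omega)⟩
    exact h1.extend hp hd (by omega) le_rfl (by omega) hd'
  · rintro ⟨⟨h1, h2⟩, h3⟩
    refine ⟨?_, fun d hd hlt hd' => h2 d hd hlt (hd'.mono (by omega) le_rfl)⟩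
    intro i hi hj
    rcases Nat.eq_or_lt_of_le hi with rfl | hi
    · exact h3
    · exact h1 i hi hj

lemma HH_right {u : ℕ → ℕ} {n p a b : ℕ} (hp : 1 ≤ p) (hs : a + (b + 1) + p ≤ n) :
    HH u n p a b ↔ HH u n p a (b + 1) ∧ u (n - (b + 1) - p) = u (n - (b + 1)) := by
  constructor
  · rintro ⟨h1, h2⟩
    refine ⟨⟨h1.mono le_rfl (by omega), fun d hd hlt hd' => h2 d hd hlt ?_⟩, ?_⟩
    · exact h1.extend hp hd le_rfl (by omega) (by omega) hd'
    · have := h1 (n - (b + 1) - p) (by omega) (by omega)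
      rwa [show n - (b + 1) - p + p = n - (b + 1) by omega] at this
  · rintro ⟨⟨h1, h2⟩, h3⟩
    refine ⟨?_, fun d hd hlt hd' => h2 d hd hlt (hd'.mono le_rfl (by omega))⟩
    intro i hi hj
    by_cases h : i + p < n - (b + 1)
    · exact h1 i hi h
    · rw [show i + p = n - (b + 1) by omega, ← h3]; congr 1; omega

lemma card_Lset {σ n p a b : ℕ} (hp : 1 ≤ p) (hs : a + b + p ≤ n) :
    ((Lset σ n p a b).card : ℝ) = Prim σ p * NN σ a * (σ : ℝ) ^ b := by
  classical
  rcases a with _ | a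
  · have : Lset σ n p 0 b = Hset σ n p 0 b := by
      unfold Lset Hset; simp
    rw [this, card_Hset hp hs]; simp [NN]
  · have h1 : Hset σ n p (a + 1) b = Lset σ n p (a + 1) b ∪ Hset σ n p a b := by
      ext v
      simp only [Hset, Lset, Finset.mem_union, Finset.mem_filter, Finset.mem_univ, true_and]
      rw [HH_left (a := a) hp (by omega)]
      simp only [Nat.add_sub_cancel, Nat.succ_pos, forall_const]
      tauto
    have h2 : Disjoint (Lset σ n p (a + 1) b) (Hset σ n p a b) := by
      rw [Finset.disjoint_left]
      intro v
      simp only [Hset, Lset, Finset.mem_filter, Finset.mem_univ, true_and]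
      rw [HH_left (a := a) hp (by omega)]
      simp only [Nat.add_sub_cancel, Nat.succ_pos, forall_const]
      tauto
    have h3 := congrArg (fun s => (Finset.card s : ℝ)) h1
    simp only [Finset.card_union_of_disjoint h2] at h3
    push_cast at h3
    rw [card_Hset hp hs, card_Hset hp (by omega)] at h3
    simp only [NN, Nat.succ_ne_zero, if_false, Nat.add_sub_cancel]
    linarith

lemma card_Fset {σ n p a b : ℕ} (hp : 1 ≤ p) (hs : a + b + p ≤ n) :
    ((Fset σ n p a b).card : ℝ) = Prim σ p * NN σ a * NN σ b := by
  classical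
  rcases b with _ | b
  · have : Fset σ n p a 0 = Lset σ n p a 0 := by
      unfold Lset Fset FF; simp
    rw [this, card_Lset hp hs]; simp [NN]
  · have h1 : Lset σ n p a (b + 1) = Fset σ n p a (b + 1) ∪ Lset σ n p a b := by
      ext v
      simp only [Fset, Lset, Finset.mem_union, Finset.mem_filter, Finset.mem_univ, true_and]
      rw [HH_right (b := b) hp (by omega)]
      unfold FF
      simp only [Nat.succ_pos, forall_const]
      tauto
    have h2 : Disjoint (Fset σ n p a (b + 1)) (Lset σ n p a b) := by
      rw [Finset.disjoint_left]
      intro v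
      simp only [Fset, Lset, Finset.mem_filter, Finset.mem_univ, true_and]
      rw [HH_right (b := b) hp (by omega)]
      unfold FF
      simp only [Nat.succ_pos, forall_const]
      tauto
    have h3 := congrArg (fun s => (Finset.card s : ℝ)) h1
    simp only [Finset.card_union_of_disjoint h2] at h3
    push_cast at h3
    rw [card_Lset hp hs, card_Lset hp (by omega)] at h3
    have : NN σ (b + 1) = (σ : ℝ) ^ (b + 1) - (σ : ℝ) ^ b := by simp [NN]
    rw [this]
    linarith

def idx (w : ℕ) : Finset (Σ _ : ℕ, Σ _ : ℕ, ℕ) :=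
  (Finset.Icc 1 w).sigma fun p => (Finset.range (w + 1 - p)).sigma fun a =>
    Finset.range (w + 1 - p - a)

lemma mem_idx {w : ℕ} {x : Σ _ : ℕ, Σ _ : ℕ, ℕ} :
    x ∈ idx w ↔ 1 ≤ x.1 ∧ x.1 + x.2.1 + x.2.2 ≤ w := by
  simp only [idx, Finset.mem_sigma, Finset.mem_Icc, Finset.mem_range]
  omega

lemma RepSet_eq {σ k w : ℕ} (hk : w ≤ k) :
    RepSet σ k w = (idx w).biUnion fun x => Fset σ (w + k) x.1 x.2.1 x.2.2 := by
  classical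
  ext v
  simp only [RepSet, Finset.mem_filter, Finset.mem_univ, true_and, Finset.mem_biUnion, Fset]
  constructor
  · rintro ⟨i, j, hne, he⟩
    wlog hij : i.1 < j.1 generalizing i j
    · exact this j i hne.symm he.symm (by
        have : i.1 ≠ j.1 := fun h => hne (Fin.ext h)
        omega)
    rw [kmer_eq_iff] at he
    obtain ⟨p, a, b, h1, h2, h3⟩ := FF.exists hk hij (by omega) he
    exact ⟨⟨p, a, b⟩, mem_idx.2 ⟨h1, h2⟩, h3⟩
  · rintro ⟨⟨p, a, b⟩, hx, h⟩
    rw [mem_idx] at hx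
    simp only at hx h
    refine ⟨⟨a, by omega⟩, ⟨a + p, by omega⟩, ?_, ?_⟩
    · intro h; have := congrArg Fin.val h; simp at this; omega
    · rw [kmer_eq_iff]
      apply h.conv <;> simp
      any_goals omega

lemma Fset_disj {σ k w : ℕ} (hk : w ≤ k) :
    Set.PairwiseDisjoint (idx w : Set (Σ _ : ℕ, Σ _ : ℕ, ℕ))
      (fun x => Fset σ (w + k) x.1 x.2.1 x.2.2) := by
  classical
  have aux : ∀ (u : ℕ → ℕ) (p a b p' a' b' : ℕ), 1 ≤ p → p + a + b ≤ w → 1 ≤ p' →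
      p' + a' + b' ≤ w → FF u (w + k) p a b → FF u (w + k) p' a' b' →
      p' ∣ p ∧ a' ≤ a ∧ b' ≤ b := by
    intro u p a b p' a' b' h1 h2 h1' h2' h h'
    have e1 := h'.key h1' h2' hk (i := a) (j := a + p) (by omega) (by omega)
      (h.conv le_rfl (by omega) (by omega) (by omega) (by simp [Nat.ModEq]))
    have e2 := h'.key h1' h2' hk (i := w - b - p) (j := w - b) (by omega) (by omega)
      (h.conv (by omega) (by omega) (by omega) (by omega) (by
        rw [Nat.modEq_iff_dvd' (by omega)]; exact ⟨1, by omega⟩))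
    refine ⟨?_, e1.1, by omega⟩
    simpa using e1.2.2
  rintro ⟨p, a, b⟩ hx ⟨p', a', b'⟩ hx' hne
  rw [Function.onFun, Finset.disjoint_left]
  intro v hv hv'
  simp only [Fset, Finset.mem_filter, Finset.mem_univ, true_and] at hv hv'
  have hx := mem_idx.1 hx
  have hx' := mem_idx.1 hx'
  simp only at hx hx'
  obtain ⟨a1, a2, a3⟩ := aux _ _ _ _ _ _ _ hx.1 hx.2 hx'.1 hx'.2 hv hv'
  obtain ⟨b1, b2, b3⟩ := aux _ _ _ _ _ _ _ hx'.1 hx'.2 hx.1 hx.2 hv' hv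
  obtain rfl := Nat.dvd_antisymm a1 b1
  obtain rfl := le_antisymm a2 b2
  obtain rfl := le_antisymm a3 b3
  exact hne rfl

/-- nested sum -/
noncomputable def WW (w : ℕ) (f : ℕ → ℕ → ℕ → ℝ) : ℝ :=
  ∑ p ∈ Finset.Icc 1 w, ∑ a ∈ Finset.range (w + 1 - p), ∑ b ∈ Finset.range (w + 1 - p - a), f p a b

lemma Dev_eq {σ k w : ℕ} (hk : w ≤ k) :
    Dev σ k w = WW w (fun p a b => Prim σ p * NN σ a * NN σ b *
      ((if b = 0 then 1 else 2) / ((p + a + b : ℕ) : ℝ) - 2 / ((w : ℝ) + 1))) := by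
  classical
  have h1 : Dev σ k w = ∑ v ∈ RepSet σ k w, (Pgc σ k w v - 2 / ((w : ℝ) + 1)) := by
    rw [Finset.sum_sub_distrib, Finset.sum_const, nsmul_eq_mul, Dev, mul_comm (2 / ((w:ℝ) + 1))]
  rw [h1, RepSet_eq hk, Finset.sum_biUnion (Fset_disj hk)]
  have h2 : ∀ x ∈ idx w, ∑ v ∈ Fset σ (w + k) x.1 x.2.1 x.2.2, (Pgc σ k w v - 2 / ((w : ℝ) + 1)) =
      Prim σ x.1 * NN σ x.2.1 * NN σ x.2.2 *
      ((if x.2.2 = 0 then 1 else 2) / ((x.1 + x.2.1 + x.2.2 : ℕ) : ℝ) - 2 / ((w : ℝ) + 1)) := by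
    intro x hx
    rw [mem_idx] at hx
    rw [← card_Fset (n := w + k) hx.1 (by omega), ← nsmul_eq_mul, ← Finset.sum_const]
    refine Finset.sum_congr rfl fun v hv => ?_
    simp only [Fset, Finset.mem_filter, Finset.mem_univ, true_and] at hv
    rw [Pgc_FF hv hx.1 hx.2 hk]
  rw [Finset.sum_congr rfl h2]
  unfold idx WW
  rw [Finset.sum_sigma]
  refine Finset.sum_congr rfl fun p _ => ?_
  rw [Finset.sum_sigma]

lemma WW_succ (w : ℕ) (f : ℕ → ℕ → ℕ → ℝ) :
    WW (w + 1) f = WW w f + ∑ p ∈ Finset.Icc 1 (w + 1), ∑ a ∈ Finset.range (w + 2 - p),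
      f p a (w + 1 - p - a) := by
  have h1 : WW w f = ∑ p ∈ Finset.Icc 1 (w + 1), ∑ a ∈ Finset.range (w + 2 - p),
      ∑ b ∈ Finset.range (w + 1 - p - a), f p a b := by
    unfold WW
    rw [Finset.sum_Icc_succ_top (by omega)]
    have : ∑ a ∈ Finset.range (w + 2 - (w + 1)),
      ∑ b ∈ Finset.range (w + 1 - (w + 1) - a), f (w + 1) a b = 0 := by
      refine Finset.sum_eq_zero fun a _ => ?_
      simp
    rw [this, add_zero]
    refine Finset.sum_congr rfl fun p hp => ?_
    rw [Finset.mem_Icc] at hp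
    rw [show w + 2 - p = (w + 1 - p) + 1 by omega, Finset.sum_range_succ]
    simp
  rw [h1, ← Finset.sum_add_distrib]
  unfold WW
  refine Finset.sum_congr rfl fun p hp => ?_
  rw [← Finset.sum_add_distrib]
  refine Finset.sum_congr (by rfl) fun a ha => ?_
  rw [Finset.mem_Icc] at hp
  rw [Finset.mem_range] at ha
  rw [show w + 1 + 1 - p - a = (w + 1 - p - a) + 1 by omega, Finset.sum_range_succ]

lemma WW_mul (w : ℕ) (f : ℕ → ℕ → ℕ → ℝ) (c : ℝ) :
    WW w (fun p a b => c * f p a b) = c * WW w f := by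
  simp only [WW, Finset.mul_sum]

lemma WW_sub (w : ℕ) (f g : ℕ → ℕ → ℕ → ℝ) :
    WW w (fun p a b => f p a b - g p a b) = WW w f - WW w g := by
  simp only [WW, Finset.sum_sub_distrib]

lemma delta1 {σ k w : ℕ} (hk : w + 1 ≤ k) :
    Dev σ k (w + 1) - Dev σ k w =
      2 / (((w : ℝ) + 1) * ((w : ℝ) + 2)) *
        WW (w + 1) (fun p a b => Prim σ p * NN σ a * NN σ b) -
      (∑ p ∈ Finset.Icc 1 (w + 1), Prim σ p * NN σ (w + 1 - p)) / ((w : ℝ) + 1) := by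
  rw [Dev_eq hk, Dev_eq (by omega : w ≤ k), WW_succ, add_sub_right_comm, ← WW_sub]
  have hw1 : (w : ℝ) + 1 ≠ 0 := by positivity
  have hw2 : (w : ℝ) + 2 ≠ 0 := by positivity
  have e1 : (fun p a b => (Prim σ p * NN σ a * NN σ b *
      ((if b = 0 then 1 else 2) / ((p + a + b : ℕ) : ℝ) - 2 / (((w + 1 : ℕ) : ℝ) + 1)) -
      Prim σ p * NN σ a * NN σ b *
      ((if b = 0 then 1 else 2) / ((p + a + b : ℕ) : ℝ) - 2 / ((w : ℝ) + 1)))) =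
      fun p a b => (2 / (((w : ℝ) + 1) * ((w : ℝ) + 2))) * (Prim σ p * NN σ a * NN σ b) := by
    funext p a b
    have : 2 / ((w : ℝ) + 1) - 2 / (((w + 1 : ℕ) : ℝ) + 1) =
        2 / (((w : ℝ) + 1) * ((w : ℝ) + 2)) := by
      push_cast
      rw [show (w : ℝ) + 1 + 1 = w + 2 by ring]
      field_simp
      ring
    rw [← this]; ring
  rw [e1, WW_mul, WW_succ w (fun p a b => Prim σ p * NN σ a * NN σ b), mul_add (2 / (((w : ℝ) + 1) * ((w : ℝ) + 2))), add_sub_assoc]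
  congr 1
  rw [Finset.sum_div, Finset.mul_sum, ← Finset.sum_sub_distrib]
  refine Finset.sum_congr rfl fun p hp => ?_
  rw [Finset.mem_Icc] at hp
  have e2 : (Prim σ p : ℝ) * NN σ (w + 1 - p) / ((w : ℝ) + 1) =
      ∑ a ∈ Finset.range (w + 2 - p),
        if a = w + 1 - p then (Prim σ p : ℝ) * NN σ (w + 1 - p) / ((w : ℝ) + 1) else 0 := by
    rw [Finset.sum_ite_eq', if_pos (by rw [Finset.mem_range]; omega)]
  rw [e2, Finset.mul_sum, ← Finset.sum_sub_distrib]
  refine Finset.sum_congr rfl fun a ha => ?_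
  rw [Finset.mem_range] at ha
  rw [show p + a + (w + 1 - p - a) = w + 1 by omega]
  push_cast
  rw [show (w : ℝ) + 1 + 1 = w + 2 by ring]
  by_cases h : a = w + 1 - p
  · subst h
    simp only [Nat.sub_self, if_true]
    simp only [NN, if_true]
    field_simp
    ring
  · rw [if_neg (by omega), if_neg h]
    field_simp
    ring

lemma sum_NN (σ j : ℕ) : ∑ b ∈ Finset.range (j + 1), NN σ b = (σ : ℝ) ^ j := by
  induction j with
  | zero => simp [NN]
  | succ j ih => rw [Finset.sum_range_succ, ih]; simp [NN]

lemma NN_eq {σ : ℕ} (hσ : 2 ≤ σ) (a : ℕ) :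
    NN σ a = (σ : ℝ) ^ a * (if a = 0 then 1 else ((σ : ℝ) - 1) / σ) := by
  have : (σ : ℝ) ≠ 0 := by positivity
  rcases a with _ | a
  · simp [NN]
  · simp only [NN, Nat.succ_ne_zero, if_false, Nat.add_sub_cancel]
    field_simp
    ring

lemma sum_NN2 {σ : ℕ} (hσ : 2 ≤ σ) (j : ℕ) :
    ∑ a ∈ Finset.range (j + 1), NN σ a * (σ : ℝ) ^ (j - a) =
      (σ : ℝ) ^ j * (1 + j * (((σ : ℝ) - 1) / σ)) := by
  have : ∀ a ∈ Finset.range (j + 1), NN σ a * (σ : ℝ) ^ (j - a) =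
      (σ : ℝ) ^ j * (if a = 0 then 1 else ((σ : ℝ) - 1) / σ) := by
    intro a ha
    rw [Finset.mem_range] at ha
    rw [NN_eq hσ, mul_right_comm, ← pow_add, show a + (j - a) = j by omega]
  rw [Finset.sum_congr rfl this, ← Finset.mul_sum, Finset.sum_range_succ']
  simp; left; ring

noncomputable def yy (σ p : ℕ) : ℝ := 1 - Prim σ p / (σ : ℝ) ^ p

lemma Prim_yy {σ : ℕ} (hσ : 2 ≤ σ) (p : ℕ) : (Prim σ p : ℝ) = (1 - yy σ p) * (σ : ℝ) ^ p := by
  have : (σ : ℝ) ≠ 0 := by positivity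
  unfold yy; field_simp; ring

lemma sum_lin (w : ℕ) (c s : ℝ) :
    ∑ p ∈ Finset.Icc 1 w, (2 + (c - 2 * p) * s) = 2 * w + (c * w - w * (w + 1)) * s := by
  induction w with
  | zero => simp
  | succ w ih => rw [Finset.sum_Icc_succ_top (by omega), ih]; push_cast; ring

lemma delta2 {σ k w : ℕ} (hσ : 2 ≤ σ) (hk : w + 1 ≤ k) (hw : 1 ≤ w) :
    Dev σ k (w + 1) - Dev σ k w =
      (w * (σ : ℝ) - ∑ p ∈ Finset.Icc 1 w, (σ : ℝ) ^ 2 * yy σ p *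
        (2 + ((w : ℝ) - 2 * p) * (((σ : ℝ) - 1) / σ)) + w * ((σ : ℝ) ^ 2 * yy σ (w + 1))) /
      (((w : ℝ) + 1) * ((w : ℝ) + 2)) * (σ : ℝ) ^ (w - 1) := by
  have hσ0 : (σ : ℝ) ≠ 0 := by positivity
  have hw1 : (w : ℝ) + 1 ≠ 0 := by positivity
  have hw2 : (w : ℝ) + 2 ≠ 0 := by positivity
  set s : ℝ := ((σ : ℝ) - 1) / σ with hs
  have hs' : s = 1 - 1 / σ := by rw [hs]; field_simp
  have e1 : WW (w + 1) (fun p a b => Prim σ p * NN σ a * NN σ b) =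
      ∑ p ∈ Finset.Icc 1 (w + 1), (σ : ℝ) ^ (w + 1) * ((1 - yy σ p) * (1 + (w + 1 - p) * s)) := by
    unfold WW
    refine Finset.sum_congr rfl fun p hp => ?_
    rw [Finset.mem_Icc] at hp
    have : ∀ a ∈ Finset.range (w + 1 + 1 - p), ∑ b ∈ Finset.range (w + 1 + 1 - p - a),
        (Prim σ p : ℝ) * NN σ a * NN σ b =
        (Prim σ p : ℝ) * (NN σ a * (σ : ℝ) ^ ((w + 1 - p) - a)) := by
      intro a ha
      rw [Finset.mem_range] at ha
      rw [← Finset.mul_sum, show w + 1 + 1 - p - a = (w + 1 - p - a) + 1 by omega, sum_NN]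
      ring
    rw [Finset.sum_congr rfl this, ← Finset.mul_sum,
      show w + 1 + 1 - p = (w + 1 - p) + 1 by omega, sum_NN2 hσ, Prim_yy hσ, ← hs]
    rw [Nat.cast_sub hp.2]
    have : (σ : ℝ) ^ (w + 1) = (σ : ℝ) ^ p * (σ : ℝ) ^ (w + 1 - p) := by
      rw [← pow_add]; congr 1; omega
    rw [this]; push_cast; ring
  have e2 : ∀ p ∈ Finset.Icc 1 (w + 1), (Prim σ p : ℝ) * NN σ (w + 1 - p) =
      (σ : ℝ) ^ (w + 1) * ((1 - yy σ p) * (if p = w + 1 then 1 else s)) := by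
    intro p hp
    rw [Finset.mem_Icc] at hp
    rw [Prim_yy hσ, NN_eq hσ, ← hs]
    have : (σ : ℝ) ^ (w + 1) = (σ : ℝ) ^ p * (σ : ℝ) ^ (w + 1 - p) := by
      rw [← pow_add]; congr 1; omega
    rw [this]
    have : (w + 1 - p = 0) ↔ p = w + 1 := by omega
    simp only [this]; ring
  rw [delta1 hk, e1, Finset.sum_congr rfl e2, ← Finset.mul_sum, ← Finset.mul_sum,
    Finset.sum_Icc_succ_top (by omega), Finset.sum_Icc_succ_top (by omega)]
  have e3 : ∑ p ∈ Finset.Icc 1 w, (1 - yy σ p) * (if p = w + 1 then 1 else s) =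
      ∑ p ∈ Finset.Icc 1 w, (1 - yy σ p) * s := by
    refine Finset.sum_congr rfl fun p hp => ?_
    rw [Finset.mem_Icc] at hp
    rw [if_neg (by omega)]
  rw [e3, if_pos rfl]
  have e4 : (∑ p ∈ Finset.Icc 1 w, (1 - yy σ p) * (1 + ((w : ℝ) + 1 - p) * s)) * 2 -
      (w + 2) * (∑ p ∈ Finset.Icc 1 w, (1 - yy σ p) * s) =
      (2 * w - w * s) - ∑ p ∈ Finset.Icc 1 w, yy σ p * (2 + ((w : ℝ) - 2 * p) * s) := by
    have := sum_lin w w s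
    rw [show 2 * (w : ℝ) - w * s = 2 * w + (w * w - w * (w + 1)) * s by ring, ← this,
      Finset.sum_mul, Finset.mul_sum, ← Finset.sum_sub_distrib, ← Finset.sum_sub_distrib]
    refine Finset.sum_congr rfl fun p _ => ?_
    ring
  have e5 : ∑ p ∈ Finset.Icc 1 w, (σ : ℝ) ^ 2 * yy σ p * (2 + ((w : ℝ) - 2 * p) * s) =
      (σ : ℝ) ^ 2 * ∑ p ∈ Finset.Icc 1 w, yy σ p * (2 + ((w : ℝ) - 2 * p) * s) := by
    rw [Finset.mul_sum]
    refine Finset.sum_congr rfl fun p _ => ?_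
    ring
  rw [e5]
  have e6 : (σ : ℝ) ^ (w + 1) = (σ : ℝ) ^ (w - 1) * (σ : ℝ) ^ 2 := by
    rw [← pow_add]; congr 1; omega
  rw [e6]
  set A := ∑ p ∈ Finset.Icc 1 w, (1 - yy σ p) * (1 + ((w : ℝ) + 1 - p) * s)
  set B := ∑ p ∈ Finset.Icc 1 w, (1 - yy σ p) * s
  set D := ∑ p ∈ Finset.Icc 1 w, yy σ p * (2 + ((w : ℝ) - 2 * p) * s)
  have hA : A = ((2 * w - w * s) - D + (w + 2) * B) / 2 := by linarith
  have hsσ : s * σ ^ 2 = σ ^ 2 - σ := by rw [hs]; field_simp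
  have hsσ' : s * σ = σ - 1 := by rw [hs]; field_simp
  rw [hA]
  clear_value A B D s
  push_cast
  field_simp
  linear_combination (-(w : ℝ)) * hsσ'
lemma card_per_le {σ p d : ℕ} (hd : 1 ≤ d) (hdp : d < p) :
    Nat.card {s : Fin p → Fin σ // HasPeriod σ p s d} ≤ σ ^ d := by
  have hper : ∀ s : Fin p → Fin σ, HasPeriod σ p s d → Per (ext' σ p s) 0 p d := by
    intro s hs i _ hi
    rw [ext'_eq s (by omega), ext'_eq s hi]
    exact congrArg Fin.val (hs i hi)
  have : Function.Injective (fun (s : {s : Fin p → Fin σ // HasPeriod σ p s d}) (j : Fin d) =>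
      s.1 ⟨j.1, by have := j.2; omega⟩) := by
    rintro ⟨s, hs⟩ ⟨t, ht⟩ h
    ext i
    have hm := Nat.mod_lt i.1 hd
    have h1 := congrFun h ⟨i.1 % d, hm⟩
    simp only at h1
    have e1 := (hper s hs).congr (i := i.1) (j := i.1 % d) (by omega) i.2 (by omega) (by omega)
      (Nat.mod_modEq _ _).symm
    have e2 := (hper t ht).congr (i := i.1) (j := i.1 % d) (by omega) i.2 (by omega) (by omega)
      (Nat.mod_modEq _ _).symm
    rw [ext'_eq _ i.2, ext'_eq _ (by omega)] at e1 e2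
    simp only [Fin.eta] at e1 e2
    rw [e1, e2, h1]
  have := Nat.card_le_card_of_injective _ this
  simpa using this

lemma card_per_ge {σ p d : ℕ} (hd : 1 ≤ d) (hdp : d < p) :
    σ ^ d ≤ Nat.card {s : Fin p → Fin σ // HasPeriod σ p s d} := by
  have : Function.Injective (fun (r : Fin d → Fin σ) =>
      (⟨fun i => r ⟨i.1 % d, Nat.mod_lt _ hd⟩, fun i h => by simp⟩ :
        {s : Fin p → Fin σ // HasPeriod σ p s d})) := by
    intro r r' h
    funext j
    have := congrFun (congrArg Subtype.val h) ⟨j.1, by have := j.2; omega⟩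
    simpa [Nat.mod_eq_of_lt] using this
  have := Nat.card_le_card_of_injective _ this
  simpa using this

lemma yy_eq {σ : ℕ} (hσ : 2 ≤ σ) (p : ℕ) :
    yy σ p = (Nat.card {s : Fin p → Fin σ // ¬ IsPrimitive σ p s} : ℝ) / (σ : ℝ) ^ p := by
  classical
  have hσ0 : (σ : ℝ) ≠ 0 := by positivity
  have h := Fintype.card_subtype_compl (fun s : Fin p → Fin σ => IsPrimitive σ p s)
  have h2 := Fintype.card_subtype_le (fun s : Fin p → Fin σ => IsPrimitive σ p s)
  have h3 : Nat.card {s : Fin p → Fin σ // ¬ IsPrimitive σ p s} + Prim σ p = σ ^ p := by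
    rw [Prim, Nat.card_eq_fintype_card, Nat.card_eq_fintype_card, h, Nat.sub_add_cancel h2]
    simp
  have h4 : (Nat.card {s : Fin p → Fin σ // ¬ IsPrimitive σ p s} : ℝ) + Prim σ p = (σ : ℝ) ^ p := by
    exact_mod_cast h3
  unfold yy
  field_simp
  linarith

lemma yy_nonneg {σ : ℕ} (hσ : 2 ≤ σ) (p : ℕ) : 0 ≤ yy σ p := by
  rw [yy_eq hσ]; positivity

lemma yy_ge {σ p d : ℕ} (hσ : 2 ≤ σ) (hd : 1 ≤ d) (hdp : d < p) (h : d ∣ p) :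
    (σ : ℝ) ^ d / (σ : ℝ) ^ p ≤ yy σ p := by
  rw [yy_eq hσ]
  have h1 := card_per_ge (σ := σ) hd hdp
  have h2 : Nat.card {s : Fin p → Fin σ // HasPeriod σ p s d} ≤
      Nat.card {s : Fin p → Fin σ // ¬ IsPrimitive σ p s} :=
    Nat.card_le_card_of_injective (fun s => ⟨s.1, fun hh => hh ⟨d, h, hdp, s.2⟩⟩)
      (fun s t hst => Subtype.ext (Subtype.mk.inj hst))
  have h3 : (σ : ℝ) ^ d ≤ Nat.card {s : Fin p → Fin σ // ¬ IsPrimitive σ p s} := by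
    exact_mod_cast h1.trans h2
  gcongr

lemma geo {σ : ℕ} (hσ : 2 ≤ σ) (m : ℕ) : ∑ d ∈ Finset.Icc 1 m, σ ^ d ≤ 2 * σ ^ m := by
  induction m with
  | zero => simp
  | succ m ih =>
    rw [Finset.sum_Icc_succ_top (by omega), pow_succ]
    nlinarith [Nat.mul_le_mul_left (σ ^ m) hσ]

lemma yy_le {σ p : ℕ} (hσ : 2 ≤ σ) (hp : 1 ≤ p) : yy σ p ≤ 2 / (σ : ℝ) ^ (p - p / 2) := by
  classical
  have hσ0 : (0 : ℝ) < σ := by positivity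
  rw [yy_eq hσ]
  have h1 : Nat.card {s : Fin p → Fin σ // ¬ IsPrimitive σ p s} ≤ 2 * σ ^ (p / 2) := by
    refine le_trans ?_ (geo hσ (p / 2))
    have h2 : Finset.univ.filter (fun s : Fin p → Fin σ => ¬ IsPrimitive σ p s) ⊆
        (Finset.Icc 1 (p / 2)).biUnion
          (fun d => Finset.univ.filter (fun s : Fin p → Fin σ => HasPeriod σ p s d)) := by
      intro s hs
      simp only [Finset.mem_filter, Finset.mem_univ, true_and, IsPrimitive, not_not] at hs
      obtain ⟨d, hd, hlt, hs⟩ := hs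
      simp only [Finset.mem_biUnion, Finset.mem_Icc, Finset.mem_filter, Finset.mem_univ, true_and]
      have hd1 : 1 ≤ d := Nat.pos_of_dvd_of_pos hd hp
      refine ⟨d, ⟨hd1, ?_⟩, hs⟩
      obtain ⟨c, hc⟩ := hd
      have : 2 ≤ c := by
        rcases c with _ | _ | c
        · omega
        · omega
        · omega
      have := Nat.mul_le_mul_left d this
      omega
    rw [Nat.card_eq_fintype_card, Fintype.card_subtype]
    refine (Finset.card_le_card h2).trans (Finset.card_biUnion_le.trans ?_)
    refine Finset.sum_le_sum fun d hd => ?_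
    rw [Finset.mem_Icc] at hd
    have := card_per_le (σ := σ) (p := p) (d := d) hd.1 (by omega)
    rwa [Nat.card_eq_fintype_card, Fintype.card_subtype] at this
  have h2 : (Nat.card {s : Fin p → Fin σ // ¬ IsPrimitive σ p s} : ℝ) ≤ 2 * (σ : ℝ) ^ (p / 2) := by
    exact_mod_cast h1
  rw [div_le_div_iff₀ (by positivity) (by positivity)]
  have h3 : (σ : ℝ) ^ p = (σ : ℝ) ^ (p / 2) * (σ : ℝ) ^ (p - p / 2) := by
    rw [← pow_add]; congr 1; omega
  rw [h3]
  have : (0 : ℝ) < (σ : ℝ) ^ (p - p / 2) := by positivity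
  nlinarith

lemma yy_le' {σ p c : ℕ} (hc : 2 ≤ c) (hσ : c ≤ σ) (hp : 4 ≤ p) :
    (σ : ℝ) ^ 2 * yy σ p ≤ 2 * (c : ℝ) ^ 2 / (c : ℝ) ^ (p - p / 2) := by
  have hσ0 : (0 : ℝ) < σ := by exact_mod_cast (by omega : 0 < σ)
  have hc0 : (0 : ℝ) < c := by exact_mod_cast (by omega : 0 < c)
  obtain ⟨m, hm⟩ : ∃ m, p - p / 2 = m + 2 := ⟨p - p / 2 - 2, by omega⟩
  have h1 := yy_le (σ := σ) (p := p) (by omega) (by omega)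
  rw [hm] at h1 ⊢
  calc (σ : ℝ) ^ 2 * yy σ p ≤ (σ : ℝ) ^ 2 * (2 / (σ : ℝ) ^ (m + 2)) := by gcongr
    _ = 2 / (σ : ℝ) ^ m := by rw [pow_add]; field_simp
    _ ≤ 2 / (c : ℝ) ^ m := by gcongr
    _ = _ := by rw [pow_add]; field_simp

/-- generic tail bound -/
lemma tail_bound (f : ℕ → ℝ) (g : ℕ → ℝ) (p0 q0 : ℕ) (B : ℝ) (hf : ∀ p, p0 ≤ p → 0 ≤ f p)
    (h0 : ∑ p ∈ Finset.Icc p0 (2 * q0) , f p ≤ B - g q0) (hp0 : p0 ≤ 2 * q0 + 1)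
    (hstep : ∀ q, q0 ≤ q → f (2 * q + 1) + f (2 * q + 2) ≤ g q - g (q + 1))
    (hg : ∀ q, q0 ≤ q → 0 ≤ g q) (w : ℕ) :
    ∑ p ∈ Finset.Icc p0 w, f p ≤ B := by
  have key : ∀ q, q0 ≤ q → ∑ p ∈ Finset.Icc p0 (2 * q), f p ≤ B - g q := by
    intro q hq
    induction q, hq using Nat.le_induction with
    | base => exact h0
    | succ q hq ih =>
      rw [show 2 * (q + 1) = 2 * q + 1 + 1 by ring, Finset.sum_Icc_succ_top (by omega),
        Finset.sum_Icc_succ_top (by omega)]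
      have := hstep q hq
      rw [show 2 * q + 1 + 1 = 2 * q + 2 by ring]
      linarith
  have h1 : ∑ p ∈ Finset.Icc p0 w, f p ≤ ∑ p ∈ Finset.Icc p0 (2 * (max q0 w)), f p := by
    apply Finset.sum_le_sum_of_subset_of_nonneg
    · apply Finset.Icc_subset_Icc_right; omega
    · intro p hp _; rw [Finset.mem_Icc] at hp; exact hf p hp.1
  have := key (max q0 w) (by omega)
  have := hg (max q0 w) (by omega)
  linarith

lemma tail2 (w : ℕ) : ∑ p ∈ Finset.Icc 8 w,
    2 * (2 : ℝ) ^ 2 / (2 : ℝ) ^ (p - p / 2) * ((p : ℝ) - 15 / 2) ≤ 17 / 4 := by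
  refine tail_bound _ (fun q => (32 * (q : ℝ) - 64) / 2 ^ q) 8 4 _ ?_ ?_ (by norm_num) ?_ ?_ w
  · intro p hp
    have : (8 : ℝ) ≤ p := by exact_mod_cast hp
    apply mul_nonneg (by positivity); linarith
  · norm_num
  · intro q hq
    rw [show 2 * q + 1 - (2 * q + 1) / 2 = q + 1 by omega,
      show 2 * q + 2 - (2 * q + 2) / 2 = q + 1 by omega]
    have : (0 : ℝ) < 2 ^ q := by positivity
    rw [pow_succ]; push_cast
    apply le_of_eq
    field_simp
    ring
  · intro q hq
    have : (4 : ℝ) ≤ q := by exact_mod_cast hq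
    apply div_nonneg _ (by positivity); linarith

lemma tail3 (w : ℕ) : ∑ p ∈ Finset.Icc 7 w,
    2 * (3 : ℝ) ^ 2 / (3 : ℝ) ^ (p - p / 2) * (2 * (p : ℝ) - 13) ≤ 8 / 3 := by
  refine tail_bound _ (fun q => (72 * (q : ℝ) - 144) / 3 ^ q) 7 3 _ ?_ ?_ (by norm_num) ?_ ?_ w
  · intro p hp
    have : (7 : ℝ) ≤ p := by exact_mod_cast hp
    apply mul_nonneg (by positivity); linarith
  · norm_num
  · intro q hq
    rw [show 2 * q + 1 - (2 * q + 1) / 2 = q + 1 by omega,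
      show 2 * q + 2 - (2 * q + 2) / 2 = q + 1 by omega]
    have : (0 : ℝ) < 3 ^ q := by positivity
    rw [pow_succ]; push_cast
    apply le_of_eq
    field_simp
    ring
  · intro q hq
    have : (3 : ℝ) ≤ q := by exact_mod_cast hq
    apply div_nonneg _ (by positivity); linarith

lemma tail1 (w : ℕ) : ∑ p ∈ Finset.Icc 1 w, 2 / (2 : ℝ) ^ (p - p / 2) ≤ 4 := by
  refine tail_bound _ (fun q => 4 / 2 ^ q) 1 0 _ ?_ ?_ (by norm_num) ?_ ?_ w
  · intro p hp; positivity
  · norm_num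
  · intro q hq
    rw [show 2 * q + 1 - (2 * q + 1) / 2 = q + 1 by omega,
      show 2 * q + 2 - (2 * q + 2) / 2 = q + 1 by omega]
    rw [pow_succ]
    apply le_of_eq
    field_simp
    ring
  · intro q hq; positivity

lemma last_bound {σ w : ℕ} (hσ : 2 ≤ σ) (hw : 11 ≤ w) :
    w * ((σ : ℝ) ^ 2 * yy σ (w + 1)) ≤ 11 / 8 := by
  have h1 := yy_le' (σ := σ) (p := w + 1) (c := 2) le_rfl hσ (by omega)
  push_cast at h1
  obtain ⟨q, hq⟩ : ∃ q, w + 1 - (w + 1) / 2 = q := ⟨_, rfl⟩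
  rw [hq] at h1
  have hq6 : 6 ≤ q := by omega
  have hwq : (w : ℝ) ≤ 2 * q - 1 := by
    have : w + 1 ≤ 2 * q := by omega
    have : (w : ℝ) + 1 ≤ 2 * q := by exact_mod_cast this
    linarith
  have h2 : (64 : ℝ) * (2 * q - 1) ≤ 11 * 2 ^ q := by
    clear hwq h1 hq
    induction q, hq6 using Nat.le_induction with
    | base => norm_num
    | succ q hq ih =>
      have : (6 : ℝ) ≤ q := by exact_mod_cast hq
      rw [pow_succ]; push_cast; linarith
  have hpos : (0 : ℝ) < 2 ^ q := by positivity
  calc w * ((σ : ℝ) ^ 2 * yy σ (w + 1)) ≤ (2 * q - 1) * (2 * 2 ^ 2 / 2 ^ q) := by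
        have := yy_nonneg hσ (w + 1)
        gcongr
        exact le_trans (by positivity) hwq
    _ ≤ 11 / 8 := by
      rw [← mul_div_assoc, div_le_iff₀ hpos]; linarith

lemma split_sum (w m : ℕ) (hm : m ≤ w) (f : ℕ → ℝ) :
    ∑ p ∈ Finset.Icc 1 w, f p = ∑ p ∈ Finset.Icc 1 m, f p + ∑ p ∈ Finset.Icc (m + 1) w, f p := by
  have e : ∀ x y, Finset.Icc x y = Finset.Ico x (y + 1) := by intro x y; ext z; simp [Nat.lt_succ_iff]
  simp only [e]
  rw [Finset.sum_Ico_consecutive _ (by omega) (by omega)]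

lemma main_lower {σ w : ℕ} (hσ : 2 ≤ σ) (hw : 11 ≤ w) :
    2 * (σ : ℝ) + 6 - (8 * (σ : ℝ) ^ 2 + 2 * σ + 7) * w <
      w * (σ : ℝ) - ∑ p ∈ Finset.Icc 1 w, (σ : ℝ) ^ 2 * yy σ p *
        (2 + ((w : ℝ) - 2 * p) * (((σ : ℝ) - 1) / σ)) + w * ((σ : ℝ) ^ 2 * yy σ (w + 1)) := by
  have hσ' : (2 : ℝ) ≤ σ := by exact_mod_cast hσ
  have hσ0 : (0 : ℝ) < σ := by linarith
  have hw' : (11 : ℝ) ≤ w := by exact_mod_cast hw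
  set s : ℝ := ((σ : ℝ) - 1) / σ with hs
  have hs0 : 0 ≤ s := div_nonneg (by linarith) hσ0.le
  have hs1 : s ≤ 1 := by rw [hs, div_le_one hσ0]; linarith
  have h1 : ∑ p ∈ Finset.Icc 1 w, (σ : ℝ) ^ 2 * yy σ p * (2 + ((w : ℝ) - 2 * p) * s) ≤
      ∑ p ∈ Finset.Icc 1 w, ((σ : ℝ) ^ 2 * (2 + w)) * (2 / (2 : ℝ) ^ (p - p / 2)) := by
    refine Finset.sum_le_sum fun p hp => ?_
    rw [Finset.mem_Icc] at hp
    have hy := yy_nonneg hσ p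
    have hy1 : yy σ p ≤ 2 / (2 : ℝ) ^ (p - p / 2) := by
      refine (yy_le hσ hp.1).trans ?_
      gcongr
    have hb : 2 + ((w : ℝ) - 2 * p) * s ≤ 2 + w := by
      have : (0 : ℝ) ≤ p := by positivity
      nlinarith [mul_nonneg this hs0]
    calc (σ : ℝ) ^ 2 * yy σ p * (2 + ((w : ℝ) - 2 * p) * s)
        ≤ (σ : ℝ) ^ 2 * yy σ p * (2 + w) := by gcongr
      _ = ((σ : ℝ) ^ 2 * (2 + w)) * yy σ p := by ring
      _ ≤ _ := by gcongr
  rw [← Finset.mul_sum] at h1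
  have h2 : ((σ : ℝ) ^ 2 * (2 + w)) * ∑ p ∈ Finset.Icc 1 w, 2 / (2 : ℝ) ^ (p - p / 2) ≤
      ((σ : ℝ) ^ 2 * (2 + w)) * 4 := by
    gcongr; exact tail1 w
  have h3 : 0 ≤ w * ((σ : ℝ) ^ 2 * yy σ (w + 1)) := by
    have := yy_nonneg hσ (w + 1); positivity
  have h4 : 0 ≤ (σ : ℝ) ^ 2 * ((w : ℝ) - 11) := mul_nonneg (by positivity) (by linarith)
  have h5 : 0 ≤ (σ : ℝ) * ((w : ℝ) - 11) := mul_nonneg (by positivity) (by linarith)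
  have h6 : 0 < (σ : ℝ) ^ 2 := by positivity
  nlinarith

lemma main_upper {σ w : ℕ} (hσ : 2 ≤ σ) (hw : 11 ≤ w) :
    w * (σ : ℝ) - ∑ p ∈ Finset.Icc 1 w, (σ : ℝ) ^ 2 * yy σ p *
        (2 + ((w : ℝ) - 2 * p) * (((σ : ℝ) - 1) / σ)) + w * ((σ : ℝ) ^ 2 * yy σ (w + 1)) <
      2 * (σ : ℝ) + 6 - 1 / 10 * w := by
  have hσ' : (2 : ℝ) ≤ σ := by exact_mod_cast hσ
  have hσ0 : (0 : ℝ) < σ := by linarith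
  have hw' : (11 : ℝ) ≤ w := by exact_mod_cast hw
  set s : ℝ := ((σ : ℝ) - 1) / σ with hs
  have hs0 : 0 ≤ s := div_nonneg (by linarith) hσ0.le
  have hs1 : s ≤ 1 := by rw [hs, div_le_one hσ0]; linarith
  have hsσ : s * σ = σ - 1 := by rw [hs]; field_simp
  have hlast := last_bound hσ hw
  have y2 : (σ : ℝ) ≤ (σ : ℝ) ^ 2 * yy σ 2 := by
    have := yy_ge (p := 2) (d := 1) hσ (by norm_num) (by norm_num) (by norm_num)
    rw [div_le_iff₀ (by positivity)] at this
    linarith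
  have y3 : 1 ≤ (σ : ℝ) ^ 2 * yy σ 3 := by
    have := yy_ge (p := 3) (d := 1) hσ (by norm_num) (by norm_num) (by norm_num)
    rw [div_le_iff₀ (by positivity)] at this
    refine le_of_mul_le_mul_left ?_ hσ0
    linarith
  have y4 : 1 ≤ (σ : ℝ) ^ 2 * yy σ 4 := by
    have := yy_ge (p := 4) (d := 2) hσ (by norm_num) (by norm_num) (by norm_num)
    rw [div_le_iff₀ (by positivity)] at this
    refine le_of_mul_le_mul_left ?_ (pow_pos hσ0 2)
    linarith
  have y5 : 1 ≤ (σ : ℝ) ^ 4 * yy σ 5 := by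
    have := yy_ge (p := 5) (d := 1) hσ (by norm_num) (by norm_num) (by norm_num)
    rw [div_le_iff₀ (by positivity)] at this
    refine le_of_mul_le_mul_left ?_ hσ0
    linarith
  have y1 := yy_nonneg hσ 1
  have y6 := yy_nonneg hσ 6
  have y5' := yy_nonneg hσ 5
  have b1 : 0 ≤ (σ : ℝ) ^ 2 * yy σ 1 * (2 + ((w : ℝ) - 2 * 1) * s) :=
    mul_nonneg (by positivity) (by nlinarith)
  have b2 : (σ : ℝ) * (2 + ((w : ℝ) - 2 * 2) * s) ≤
      (σ : ℝ) ^ 2 * yy σ 2 * (2 + ((w : ℝ) - 2 * 2) * s) :=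
    mul_le_mul_of_nonneg_right y2 (by nlinarith)
  have b3 : 1 * (2 + ((w : ℝ) - 2 * 3) * s) ≤
      (σ : ℝ) ^ 2 * yy σ 3 * (2 + ((w : ℝ) - 2 * 3) * s) :=
    mul_le_mul_of_nonneg_right y3 (by nlinarith)
  have b4 : 1 * (2 + ((w : ℝ) - 2 * 4) * s) ≤
      (σ : ℝ) ^ 2 * yy σ 4 * (2 + ((w : ℝ) - 2 * 4) * s) :=
    mul_le_mul_of_nonneg_right y4 (by nlinarith)
  have b6 : 0 ≤ (σ : ℝ) ^ 2 * yy σ 6 * (2 + ((w : ℝ) - 2 * 6) * s) :=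
    mul_nonneg (by positivity) (by nlinarith)
  have hsum6 : ∀ f : ℕ → ℝ, ∑ p ∈ Finset.Icc 1 6, f p = f 1 + f 2 + f 3 + f 4 + f 5 + f 6 := by
    intro f
    rw [show Finset.Icc 1 6 = ({1, 2, 3, 4, 5, 6} : Finset ℕ) by rfl]
    simp; ring
  have hcomb : (σ : ℝ) * (2 + ((w : ℝ) - 2 * 2) * s) = 2 * σ + ((w : ℝ) - 4) * (σ - 1) := by
    rw [← hsσ]; ring
  rw [split_sum w 6 (by omega), hsum6]
  push_cast
  rcases Nat.eq_or_lt_of_le hσ with rfl | h3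
  · have hs2 : s = 1 / 2 := by rw [hs]; norm_num
    have b5 : 1 / 4 * (2 + ((w : ℝ) - 2 * 5) * s) ≤
      ((2 : ℕ) : ℝ) ^ 2 * yy 2 5 * (2 + ((w : ℝ) - 2 * 5) * s) :=
      mul_le_mul_of_nonneg_right (by push_cast at y5 ⊢; linarith) (by nlinarith)
    have e7 : ∑ p ∈ Finset.Icc 7 w, ((2 : ℕ) : ℝ) ^ 2 * yy 2 p * (2 + ((w : ℝ) - 2 * p) * s) =
        ((2 : ℕ) : ℝ) ^ 2 * yy 2 7 * (2 + ((w : ℝ) - 2 * 7) * s) + 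
        ∑ p ∈ Finset.Icc 8 w, ((2 : ℕ) : ℝ) ^ 2 * yy 2 p * (2 + ((w : ℝ) - 2 * p) * s) := by
      rw [← Finset.add_sum_Ioc_eq_sum_Icc (by omega : 7 ≤ w)]
      rfl
    have b7 : 0 ≤ ((2 : ℕ) : ℝ) ^ 2 * yy 2 7 * (2 + ((w : ℝ) - 2 * 7) * s) := by
      have := yy_nonneg hσ 7
      exact mul_nonneg (by positivity) (by rw [hs2]; linarith)
    have htail : -(17 / 4) ≤
        ∑ p ∈ Finset.Icc 8 w, ((2 : ℕ) : ℝ) ^ 2 * yy 2 p * (2 + ((w : ℝ) - 2 * p) * s) := by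
      rw [neg_le]
      refine le_trans ?_ (tail2 w)
      rw [← Finset.sum_neg_distrib]
      refine Finset.sum_le_sum fun p hp => ?_
      rw [Finset.mem_Icc] at hp
      have hp8 : (8 : ℝ) ≤ p := by exact_mod_cast hp.1
      have hy := yy_le' (σ := 2) (p := p) (c := 2) le_rfl le_rfl (by omega)
      have hy0 := yy_nonneg hσ p
      rw [← mul_neg]
      calc ((2 : ℕ) : ℝ) ^ 2 * yy 2 p * -(2 + ((w : ℝ) - 2 * p) * s)
          ≤ ((2 : ℕ) : ℝ) ^ 2 * yy 2 p * ((p : ℝ) - 15 / 2) := by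
            apply mul_le_mul_of_nonneg_left _ (by positivity)
            rw [hs2]; linarith
        _ ≤ _ := by
            apply mul_le_mul_of_nonneg_right _ (by linarith)
            exact_mod_cast hy
    rw [e7]
    clear_value s
    subst hs2
    push_cast at *
    linarith
  · have h3' : (3 : ℝ) ≤ σ := by exact_mod_cast h3
    have hs3 : 2 / 3 ≤ s := by rw [hs, le_div_iff₀ hσ0]; linarith
    have b5 : 0 ≤ (σ : ℝ) ^ 2 * yy σ 5 * (2 + ((w : ℝ) - 2 * 5) * s) :=
      mul_nonneg (by positivity) (by nlinarith)
    have htail : -(8 / 3) ≤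
        ∑ p ∈ Finset.Icc 7 w, (σ : ℝ) ^ 2 * yy σ p * (2 + ((w : ℝ) - 2 * p) * s) := by
      rw [neg_le]
      refine le_trans ?_ (tail3 w)
      rw [← Finset.sum_neg_distrib]
      refine Finset.sum_le_sum fun p hp => ?_
      rw [Finset.mem_Icc] at hp
      have hp7 : (7 : ℝ) ≤ p := by exact_mod_cast hp.1
      have hy := yy_le' (σ := σ) (p := p) (c := 3) (by norm_num) h3 (by omega)
      have hy0 := yy_nonneg hσ p
      rw [← mul_neg]
      calc (σ : ℝ) ^ 2 * yy σ p * -(2 + ((w : ℝ) - 2 * p) * s)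
          ≤ (σ : ℝ) ^ 2 * yy σ p * (2 * (p : ℝ) - 13) := by
            apply mul_le_mul_of_nonneg_left _ (by positivity)
            nlinarith [mul_nonneg (by linarith : (0 : ℝ) ≤ (w : ℝ) - 11) hs0,
              mul_nonneg (by linarith : (0 : ℝ) ≤ 2 * (p : ℝ) - 11) (by linarith : 0 ≤ 1 - s)]
        _ ≤ _ := by
            apply mul_le_mul_of_nonneg_right _ (by linarith)
            exact_mod_cast hy
    have hx : (2 / 3) * (2 * (w : ℝ) - 14) ≤ s * (2 * (w : ℝ) - 14) :=
      mul_le_mul_of_nonneg_right hs3 (by linarith)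
    linarith

theorem stmt16 (σ : ℕ) (hσ : 2 ≤ σ) :
    ∃ C C' : ℝ, 0 < C ∧ 0 < C' ∧
      ∀ w k : ℕ, 11 ≤ w → w + 1 ≤ k →
        ((2 * (σ : ℝ) + 6 - C * w) / (((w : ℝ) + 1) * ((w : ℝ) + 2))) * (σ : ℝ) ^ (w - 1) <
            Dev σ k (w + 1) - Dev σ k w ∧
          Dev σ k (w + 1) - Dev σ k w <
            ((2 * (σ : ℝ) + 6 - C' * w) / (((w : ℝ) + 1) * ((w : ℝ) + 2))) * (σ : ℝ) ^ (w - 1) := by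
  
  have hσ' : (2 : ℝ) ≤ σ := by exact_mod_cast hσ
  have hσ0 : (0 : ℝ) < σ := by linarith
  refine ⟨8 * (σ : ℝ) ^ 2 + 2 * σ + 7, 1 / 10, by positivity, by norm_num, ?_⟩
  intro w k hw hk
  have hw' : (11 : ℝ) ≤ w := by exact_mod_cast hw
  rw [delta2 hσ hk (by omega)]
  have hpow : (0 : ℝ) < (σ : ℝ) ^ (w - 1) := by positivity
  have hden : (0 : ℝ) < ((w : ℝ) + 1) * ((w : ℝ) + 2) := by positivity
  constructor
  · exact mul_lt_mul_of_pos_right (div_lt_div_of_pos_right (main_lower hσ hw) hden) hpow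
  · exact mul_lt_mul_of_pos_right (div_lt_div_of_pos_right (main_upper hσ hw) hden) hpow
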